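/- Assume that Hom_R(M,X) ≠ 0 for every nonzero module X in σ[M], and let P be a proper M-ideal of M. Then P is a prime M-ideal if and only if P is a Beachy-prime M-ideal. -/

import Mathlib

universe u v

section BeachyDefs

variable (R : Type u) [Ring R]

/-- The Beachy product `N·X`: the smallest submodule `Y` of `X` such that `f(N) = 0`
for every `R`-homomorphism `f : M → X/Y`, i.e. the intersection of all such submodules. -/
def bprod (M : Type*) [AddCommGroup M] [Module R M]
    (X : Type*) [AddCommGroup X] [Module R X] (N : Submodule R M) : Submodule R X :=
  sInf {Y : Submodule R X | ∀ f : M →ₗ[R] X ⧸ Y, ∀ n ∈ N, f n = 0}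

/-- The product `N·Z` for a submodule `Z` of `X`, computed with `Z` regarded as an
`R`-module and viewed as a submodule of `X`. -/
def bprodSub (M : Type*) [AddCommGroup M] [Module R M]
    (X : Type*) [AddCommGroup X] [Module R X] (N : Submodule R M) (Z : Submodule R X) :
    Submodule R X :=
  (bprod R M (↥Z) N).map Z.subtype

/-- `N² := N·N`, a submodule of `M`. -/
def msq (M : Type*) [AddCommGroup M] [Module R M] (N : Submodule R M) : Submodule R M :=
  bprodSub R M M N N

/-- `Ann_M(X) = ⋂ { ker f : f ∈ Hom_R(M,X) }`, a submodule of `M`. -/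
def annM (M : Type*) [AddCommGroup M] [Module R M]
    (X : Type*) [AddCommGroup X] [Module R X] : Submodule R M :=
  ⨅ f : M →ₗ[R] X, LinearMap.ker f

/-- A proper submodule `P` of `X` is `M`-prime if `N·Y ⊆ P` implies `N·X ⊆ P` or `Y ⊆ P`. -/
def IsMPrimeSubmodule (M : Type*) [AddCommGroup M] [Module R M]
    (X : Type*) [AddCommGroup X] [Module R X] (P : Submodule R X) : Prop :=
  P ≠ ⊤ ∧ ∀ (N : Submodule R M) (Y : Submodule R X),
    bprodSub R M X N Y ≤ P → bprod R M X N ≤ P ∨ Y ≤ P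

/-- `X` is an `M`-prime module if `X ≠ 0` and `(0)` is an `M`-prime submodule of `X`. -/
def IsMPrimeModule (M : Type*) [AddCommGroup M] [Module R M]
    (X : Type*) [AddCommGroup X] [Module R X] : Prop :=
  IsMPrimeSubmodule R M X (⊥ : Submodule R X)

/-- A proper submodule `P` of `X` is `M`-semiprime if `N²·Y ⊆ P` implies `N·Y ⊆ P`. -/
def IsMSemiprimeSubmodule (M : Type*) [AddCommGroup M] [Module R M]
    (X : Type*) [AddCommGroup X] [Module R X] (P : Submodule R X) : Prop :=
  P ≠ ⊤ ∧ ∀ (N : Submodule R M) (Y : Submodule R X),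
    bprodSub R M X (msq R M N) Y ≤ P → bprodSub R M X N Y ≤ P

/-- `X` is an `M`-semiprime module if `X ≠ 0` and `(0)` is an `M`-semiprime submodule. -/
def IsMSemiprimeModule (M : Type*) [AddCommGroup M] [Module R M]
    (X : Type*) [AddCommGroup X] [Module R X] : Prop :=
  IsMSemiprimeSubmodule R M X (⊥ : Submodule R X)

/-- A submodule `N` of `M` is an `M`-ideal if `N = Ann_M(M/N)`. -/
def IsMIdeal (M : Type*) [AddCommGroup M] [Module R M] (N : Submodule R M) : Prop :=
  N = annM R M (M ⧸ N)

/-- The `M`-prime radical `rad_M(X)`: the intersection of all `M`-prime submodules of `X`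
(which is all of `X` when there are none). -/
def radM (M : Type*) [AddCommGroup M] [Module R M]
    (X : Type*) [AddCommGroup X] [Module R X] : Submodule R X :=
  sInf {P : Submodule R X | IsMPrimeSubmodule R M X P}

/-- An `M`-m-system in `X`. -/
def IsMmSystem (M : Type*) [AddCommGroup M] [Module R M]
    (X : Type*) [AddCommGroup X] [Module R X] (S : Set X) : Prop :=
  S.Nonempty ∧ (0 : X) ∉ S ∧
    ∀ (N : Submodule R M) (Y Z : Submodule R X),
      ((↑(Y ⊔ Z) : Set X) ∩ S).Nonempty →
      ((↑(Y ⊔ bprod R M X N) : Set X) ∩ S).Nonempty →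
      ((↑(Y ⊔ bprodSub R M X N Z) : Set X) ∩ S).Nonempty

/-- An `M`-n-system in `X`. -/
def IsMnSystem (M : Type*) [AddCommGroup M] [Module R M]
    (X : Type*) [AddCommGroup X] [Module R X] (T : Set X) : Prop :=
  T.Nonempty ∧ (0 : X) ∉ T ∧
    ∀ (N : Submodule R M) (Y Z : Submodule R X),
      ((↑(Y ⊔ bprodSub R M X N Z) : Set X) ∩ T).Nonempty →
      ((↑(Y ⊔ bprodSub R M X (msq R M N) Z) : Set X) ∩ T).Nonempty

variable (M : Type v) [AddCommGroup M] [Module R M]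

/-- A proper `M`-ideal `P` is a prime `M`-ideal if `P = Ann_M(X)` for some `M`-prime module. -/
def IsPrimeMIdeal (P : Submodule R M) : Prop :=
  IsMIdeal R M P ∧ P ≠ ⊤ ∧
    ∃ (X : Type v) (_ : AddCommGroup X) (_ : Module R X),
      IsMPrimeModule R M X ∧ P = annM R M X

/-- `X` is Beachy-`M`-prime if `Hom_R(M,X) ≠ 0` and `Ann_M(Y) = Ann_M(X)` for every
submodule `Y ⊆ X` with `Hom_R(M,Y) ≠ 0`. -/
def IsBeachyMPrimeModule (X : Type v) [AddCommGroup X] [Module R X] : Prop :=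
  (∃ f : M →ₗ[R] X, f ≠ 0) ∧
    ∀ Y : Submodule R X, (∃ g : M →ₗ[R] ↥Y, g ≠ 0) → annM R M (↥Y) = annM R M X

/-- A proper `M`-ideal `P` is a Beachy-prime `M`-ideal if `P = Ann_M(X)` for some
Beachy-`M`-prime module `X`. -/
def IsBeachyPrimeMIdeal (P : Submodule R M) : Prop :=
  IsMIdeal R M P ∧ P ≠ ⊤ ∧
    ∃ (X : Type v) (_ : AddCommGroup X) (_ : Module R X),
      IsBeachyMPrimeModule R M X ∧ P = annM R M X

/-- An `M`-ideal `P` is primitive if `P = Ann_M(S)` for some simple module `S`. -/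
def IsPrimitiveMIdeal (P : Submodule R M) : Prop :=
  IsMIdeal R M P ∧
    ∃ (S : Type v) (_ : AddCommGroup S) (_ : Module R S),
      IsSimpleModule R S ∧ P = annM R M S

/-- The prime radical `P(M)`: the intersection of all prime `M`-ideals of `M`
(all of `M` when there are none). -/
def primeRadM : Submodule R M := sInf {P : Submodule R M | IsPrimeMIdeal R M P}

/-- `X` belongs to `σ[M]`: `X` embeds in a quotient of a direct sum of copies of `M`. -/
def MemSigma (X : Type v) [AddCommGroup X] [Module R X] : Prop :=
  ∃ (ι : Type v) (K : Submodule R (ι →₀ M)) (g : X →ₗ[R] (ι →₀ M) ⧸ K),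
    Function.Injective g

/-- `M` is projective in `σ[M]`. -/
def IsProjInSigma : Prop :=
  ∀ (A : Type v) [AddCommGroup A] [Module R A] (B : Type v) [AddCommGroup B] [Module R B],
    MemSigma R M A → MemSigma R M B →
      ∀ (g : A →ₗ[R] B), Function.Surjective g →
        ∀ f : M →ₗ[R] B, ∃ h : M →ₗ[R] A, g.comp h = f

/-- `X` is a homogeneous semisimple module: a direct sum of mutually isomorphic
simple modules. -/
def IsHomogSemisimple (X : Type v) [AddCommGroup X] [Module R X] : Prop :=
  ∃ (S : Type v) (_ : AddCommGroup S) (_ : Module R S) (ι : Type v),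
    IsSimpleModule R S ∧ Nonempty (X ≃ₗ[R] (ι →₀ S))

end BeachyDefs

theorem mem_annM_iff {R : Type*} [Ring R] {M : Type*} [AddCommGroup M] [Module R M]
    {X : Type*} [AddCommGroup X] [Module R X] (m : M) :
    m ∈ annM R M X ↔ ∀ f : M →ₗ[R] X, f m = 0 := by
  simp [annM]

theorem annM_le_of_inj {R : Type*} [Ring R] {M : Type*} [AddCommGroup M] [Module R M]
    {X : Type*} [AddCommGroup X] [Module R X] {Y : Type*} [AddCommGroup Y] [Module R Y]
    (g : Y →ₗ[R] X) (hg : Function.Injective g) : annM R M X ≤ annM R M Y := by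
  intro m hm
  rw [mem_annM_iff] at *
  intro f
  apply hg
  simpa using hm (g.comp f)

theorem bprod_eq_bot_iff {R : Type*} [Ring R] {M : Type*} [AddCommGroup M] [Module R M]
    {X : Type*} [AddCommGroup X] [Module R X] (N : Submodule R M) :
    bprod R M X N = ⊥ ↔ N ≤ annM R M X := by
  constructor
  · intro h n hn
    rw [mem_annM_iff]
    intro f
    have : f n ∈ bprod R M X N := by
      unfold bprod
      rw [Submodule.mem_sInf]
      intro Y hY
      have := hY (Y.mkQ.comp f) n hn
      simpa using this
    rw [h] at this
    simpa using this
  · intro h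
    rw [eq_bot_iff]
    apply sInf_le
    intro f n hn
    have h1 := (mem_annM_iff n).1 (h hn)
      ((Submodule.quotEquivOfEqBot (⊥ : Submodule R X) rfl).toLinearMap.comp f)
    simpa using h1

theorem bprodSub_le_bot_iff {R : Type*} [Ring R] {M : Type*} [AddCommGroup M] [Module R M]
    {X : Type*} [AddCommGroup X] [Module R X] (N : Submodule R M) (Y : Submodule R X) :
    bprodSub R M X N Y ≤ ⊥ ↔ N ≤ annM R M Y := by
  rw [← bprod_eq_bot_iff, bprodSub, le_bot_iff]
  constructor
  · intro h
    apply Submodule.map_injective_of_injective Y.injective_subtype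
    rw [h, Submodule.map_bot]
  · intro h
    rw [h, Submodule.map_bot]

/-- Proposition 4.1: if `Hom_R(M,X) ≠ 0` for every nonzero `X ∈ σ[M]`, then
a proper `M`-ideal is a prime `M`-ideal iff it is a Beachy-prime `M`-ideal. -/
theorem isPrimeMIdeal_iff_isBeachyPrimeMIdeal (R : Type u) [Ring R]
    (M : Type v) [AddCommGroup M] [Module R M]
    (hhom : ∀ (X : Type v) [AddCommGroup X] [Module R X],
      MemSigma R M X → Nontrivial X → ∃ f : M →ₗ[R] X, f ≠ 0)
    (P : Submodule R M) (hid : IsMIdeal R M P) (hne : P ≠ ⊤) :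
    IsPrimeMIdeal R M P ↔ IsBeachyPrimeMIdeal R M P := by
  constructor
  · rintro ⟨_, _, X, _, _, ⟨hX, hp⟩, rfl⟩
    refine ⟨hid, hne, X, _, _, ⟨?_, ?_⟩, rfl⟩
    · by_contra! h
      apply hne
      rw [eq_top_iff]
      intro m _
      rw [mem_annM_iff]
      intro f
      simp [h f]
    · rintro Y ⟨g, hg⟩
      refine le_antisymm ?_ (annM_le_of_inj Y.subtype Y.injective_subtype)
      rcases hp (annM R M Y) Y ((bprodSub_le_bot_iff _ _).2 le_rfl) with h | h
      · exact (bprod_eq_bot_iff _).1 (le_bot_iff.1 h)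
      · exfalso
        apply hg
        ext m
        simpa using h (g m).2
  · rintro ⟨_, _, X, _, _, ⟨⟨f, hf⟩, hp⟩, rfl⟩
    have hfr : annM R M (LinearMap.range f) = annM R M X := by
      apply hp
      refine ⟨f.rangeRestrict, fun h => hf ?_⟩
      ext m
      simpa using congrArg Subtype.val (LinearMap.congr_fun h m)
    refine ⟨hid, hne, LinearMap.range f, inferInstance, inferInstance, ⟨?_, ?_⟩, hfr.symm⟩
    · intro h
      apply hf
      ext m
      have : f.rangeRestrict m ∈ (⊥ : Submodule R (LinearMap.range f)) := by
        rw [h]; trivial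
      simpa using congrArg Subtype.val ((Submodule.mem_bot R).1 this)
    · intro N Y hN
      rw [bprodSub_le_bot_iff] at hN
      by_cases hY : Y = ⊥
      · exact Or.inr hY.le
      left
      rw [le_bot_iff, bprod_eq_bot_iff, hfr]
      have hmem : MemSigma R M Y := by
        let s : (PUnit.{v+1} →₀ M) →ₗ[R] LinearMap.range f :=
          f.rangeRestrict.comp (Finsupp.lapply PUnit.unit)
        have hs : Function.Surjective s := by
          rintro ⟨_, m, rfl⟩
          exact ⟨Finsupp.single PUnit.unit m, by ext; simp [s]⟩
        refine ⟨PUnit, LinearMap.ker s,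
          (s.quotKerEquivOfSurjective hs).symm.toLinearMap.comp Y.subtype, ?_⟩
        exact (s.quotKerEquivOfSurjective hs).symm.injective.comp Y.injective_subtype
      obtain ⟨g, hg⟩ := hhom Y hmem (Submodule.nontrivial_iff_ne_bot.2 hY)
      let e := Submodule.equivMapOfInjective (LinearMap.range f).subtype
        (LinearMap.range f).injective_subtype Y
      have h1 := hp (Y.map (LinearMap.range f).subtype) ⟨e.toLinearMap.comp g, fun h => hg (by
        ext1 m
        apply e.injective
        simpa using LinearMap.congr_fun h m)⟩
      rw [← h1]
      exact hN.trans (annM_le_of_inj e.symm.toLinearMap e.symm.injective)
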